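/- Let A, B₁, …, B_p be real n×n matrices and σ₁, …, σ_p real numbers. If the matrix 𝒜 = A ⊗ I + I ⊗ A + Σ_{k=1}^p σ_k² (B_k ⊗ B_k) is Hurwitz, then A is Hurwitz. -/

import Mathlib

open Matrix
open scoped Kronecker

/-- A real square matrix is Hurwitz if every eigenvalue (as a complex number) has
strictly negative real part. -/
def IsHurwitz {m : Type*} [Fintype m] [DecidableEq m] (A : Matrix m m ℝ) : Prop :=
  ∀ μ ∈ spectrum ℂ (A.map (algebraMap ℝ ℂ)), μ.re < 0

section Spectrum

variable {m : Type*} [Fintype m] [DecidableEq m]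

lemma Matrix.mem_spectrum_iff_det_eq_zero {K : Type*} [Field K] (M : Matrix m m K) (μ : K) :
    μ ∈ spectrum K M ↔ (μ • (1 : Matrix m m K) - M).det = 0 := by
  rw [spectrum.mem_iff, Matrix.isUnit_iff_isUnit_det, isUnit_iff_ne_zero, not_not,
    Algebra.algebraMap_eq_smul_one]

/-- A Hurwitz matrix has no nonnegative real eigenvalue, so no segment point between `1` and `-M`
is singular. -/
lemma IsHurwitz.det_segment_ne_zero {M : Matrix m m ℝ} (hM : IsHurwitz M) (t : unitInterval) :
    ((1 - (t : ℝ)) • (1 : Matrix m m ℝ) - (t : ℝ) • M).det ≠ 0 := by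
  rcases eq_or_ne (t : ℝ) 0 with h0 | h0
  · simp [h0]
  intro hdet
  set r : ℝ := (1 - t) / t with hr
  have hr0 : 0 ≤ r := div_nonneg (sub_nonneg.2 t.2.2) t.2.1
  have hfac : (1 - (t : ℝ)) • (1 : Matrix m m ℝ) - (t : ℝ) • M
      = (t : ℝ) • (r • (1 : Matrix m m ℝ) - M) := by
    rw [smul_sub, smul_smul, hr, mul_div_cancel₀ _ h0]
  rw [hfac, Matrix.det_smul, mul_eq_zero] at hdet
  have hdet' : (r • (1 : Matrix m m ℝ) - M).det = 0 :=
    hdet.resolve_left (pow_ne_zero _ h0)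
  have hmem : (r : ℂ) ∈ spectrum ℂ (M.map (algebraMap ℝ ℂ)) := by
    rw [Matrix.mem_spectrum_iff_det_eq_zero]
    have h := congrArg (algebraMap ℝ ℂ) hdet'
    rw [RingHom.map_det, map_zero] at h
    rw [← h]
    congr 1
    ext i j
    simp [Matrix.one_apply, apply_ite]
  have := hM _ hmem
  simp only [Complex.ofReal_re] at this
  linarith

end Spectrum

section PosDef

variable {m : Type*} [Fintype m]

/-- Along a continuous family of symmetric matrices over a connected space in which every positive
semidefinite member is positive definite, positive definiteness propagates. -/
lemma Matrix.posDef_of_continuous_of_preconnected {X : Type*} [TopologicalSpace X]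
    [PreconnectedSpace X] {Z : X → Matrix m m ℝ} (hZ : Continuous Z)
    (hsymm : ∀ t, (Z t).IsHermitian) (hpos : ∀ t, (Z t).PosSemidef → (Z t).PosDef)
    {t₀ : X} (h₀ : (Z t₀).PosDef) (t : X) : (Z t).PosDef := by
  have hclosed : IsClosed {t | (Z t).PosDef} := by
    have heq : {t | (Z t).PosDef} = ⋂ x : m → ℝ, {t | 0 ≤ x ⬝ᵥ (Z t *ᵥ x)} := by
      ext t
      simp only [Set.mem_ofPred_eq, Set.mem_iInter]
      exact ⟨fun h x => by simpa using h.posSemidef.dotProduct_mulVec_nonneg x,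
        fun h => hpos t (.of_dotProduct_mulVec_nonneg (hsymm t) (by simpa using h))⟩
    rw [heq]
    exact isClosed_iInter fun x => isClosed_le continuous_const (by fun_prop)
  have hopen : IsOpen {t | (Z t).PosDef} := by
    let S := Metric.sphere (0 : m → ℝ) 1
    have : CompactSpace S := isCompact_iff_compactSpace.1 (isCompact_sphere _ _)
    have hC : IsClosed {q : X × S | (q.2 : m → ℝ) ⬝ᵥ (Z q.1 *ᵥ (q.2 : m → ℝ)) ≤ 0} :=
      isClosed_le (by fun_prop) continuous_const
    have heq : {t | (Z t).PosDef} =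
        (Prod.fst '' {q : X × S | (q.2 : m → ℝ) ⬝ᵥ (Z q.1 *ᵥ (q.2 : m → ℝ)) ≤ 0})ᶜ := by
      ext t
      simp only [Set.mem_ofPred_eq, Set.mem_compl_iff, Set.mem_image, Prod.exists, not_exists,
        not_and]
      constructor
      · rintro h t' x hx rfl
        have hx0 : (x : m → ℝ) ≠ 0 := Metric.ne_of_mem_sphere x.2 one_ne_zero
        have := h.dotProduct_mulVec_pos hx0
        simp only [star_trivial] at this
        linarith
      · intro h
        refine .of_dotProduct_mulVec_pos (hsymm t) fun x hx => ?_
        have hn : 0 < ‖x‖ := norm_pos_iff.2 hx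
        have hmem : ‖x‖⁻¹ • x ∈ S := by
          simp [S, norm_smul, hn.ne']
        by_contra hle
        refine h t ⟨_, hmem⟩ ?_ rfl
        simp only [star_trivial, not_lt] at hle
        simp only [mulVec_smul, smul_dotProduct, dotProduct_smul, smul_eq_mul]
        have := inv_pos.2 hn
        exact mul_nonpos_of_nonneg_of_nonpos this.le (mul_nonpos_of_nonneg_of_nonpos this.le hle)
    rw [heq]
    exact (isClosedMap_fst_of_compactSpace _ hC).isOpen_compl
  have huniv := IsClopen.eq_univ ⟨hclosed, hopen⟩ ⟨t₀, h₀⟩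
  exact huniv.ge (Set.mem_univ t)

end PosDef

section Lyapunov

variable {n ι : Type*} [Fintype n] [Fintype ι]

/-- The covariance operator `X ↦ A X + X Aᵀ + Σₖ σₖ² Bₖ X Bₖᵀ`. -/
def covarianceOperator (A : Matrix n n ℝ) (B : ι → Matrix n n ℝ) (σ : ι → ℝ)
    (X : Matrix n n ℝ) : Matrix n n ℝ :=
  A * X + X * Aᵀ + ∑ k, (σ k) ^ 2 • (B k * X * (B k)ᵀ)

variable (A : Matrix n n ℝ) (B : ι → Matrix n n ℝ) (σ : ι → ℝ)

lemma vectorized_generator_mulVec_vec [DecidableEq n] (X : Matrix n n ℝ) :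
    (A ⊗ₖ (1 : Matrix n n ℝ) + (1 : Matrix n n ℝ) ⊗ₖ A + ∑ k, (σ k) ^ 2 • (B k ⊗ₖ B k)) *ᵥ vec X
      = vec (covarianceOperator A B σ X) := by
  simp only [covarianceOperator, add_mulVec, sum_mulVec, smul_mulVec, kronecker_mulVec_vec,
    vec_add, vec_sum, vec_smul, transpose_one, Matrix.one_mul, Matrix.mul_one]
  rw [add_comm (vec (X * Aᵀ))]

lemma covarianceOperator_transpose (X : Matrix n n ℝ) :
    covarianceOperator A B σ Xᵀ = (covarianceOperator A B σ X)ᵀ := by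
  simp only [covarianceOperator, transpose_add, transpose_mul, transpose_sum, transpose_smul,
    transpose_transpose, Matrix.mul_assoc]
  rw [add_comm (A * Xᵀ)]

lemma dotProduct_covarianceOperator_mulVec (X : Matrix n n ℝ) (hX : Xᵀ = X) (x : n → ℝ) :
    x ⬝ᵥ (covarianceOperator A B σ X *ᵥ x) = 2 * ((Aᵀ *ᵥ x) ⬝ᵥ (X *ᵥ x))
      + ∑ k, (σ k) ^ 2 * (((B k)ᵀ *ᵥ x) ⬝ᵥ (X *ᵥ ((B k)ᵀ *ᵥ x))) := by
  have hmove (C : Matrix n n ℝ) (y : n → ℝ) : x ⬝ᵥ (C *ᵥ y) = (Cᵀ *ᵥ x) ⬝ᵥ y := by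
    rw [dotProduct_mulVec, mulVec_transpose]
  simp only [covarianceOperator, add_mulVec, sum_mulVec, smul_mulVec, dotProduct_add,
    dotProduct_sum, dotProduct_smul, smul_eq_mul, ← mulVec_mulVec, hmove, hX]
  rw [dotProduct_comm (X *ᵥ x), two_mul]

/-- The vectorized generator being Hurwitz yields a positive definite solution of the stationary
covariance equation. -/
lemma exists_posDef_covarianceOperator_eq_neg_one [DecidableEq n]
    (h : IsHurwitz (A ⊗ₖ (1 : Matrix n n ℝ) + (1 : Matrix n n ℝ) ⊗ₖ A
      + ∑ k, (σ k) ^ 2 • (B k ⊗ₖ B k))) :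
    ∃ Y : Matrix n n ℝ, Y.PosDef ∧ covarianceOperator A B σ Y = -1 := by
  set G := A ⊗ₖ (1 : Matrix n n ℝ) + (1 : Matrix n n ℝ) ⊗ₖ A
      + ∑ k, (σ k) ^ 2 • (B k ⊗ₖ B k) with hG
  let M : unitInterval → Matrix (n × n) (n × n) ℝ := fun t => (1 - (t : ℝ)) • 1 - (t : ℝ) • G
  have hdet (t) : IsUnit (M t).det := isUnit_iff_ne_zero.2 (h.det_segment_ne_zero t)
  have hMvec (t) (X : Matrix n n ℝ) : M t *ᵥ vec X
      = vec ((1 - (t : ℝ)) • X - (t : ℝ) • covarianceOperator A B σ X) := by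
    simp only [M, sub_mulVec, smul_mulVec, one_mulVec, vec_sub, vec_smul, hG,
      vectorized_generator_mulVec_vec]
  let Y : unitInterval → Matrix n n ℝ :=
    fun t => of fun i j => ((M t)⁻¹ *ᵥ vec (1 : Matrix n n ℝ)) (j, i)
  have hvecY (t) : vec (Y t) = (M t)⁻¹ *ᵥ vec (1 : Matrix n n ℝ) := rfl
  have hY (t : unitInterval) : (1 - (t : ℝ)) • Y t - (t : ℝ) • covarianceOperator A B σ (Y t) = 1 := by
    rw [← vec_inj, ← hMvec, hvecY, mulVec_mulVec, mul_nonsing_inv _ (hdet t), one_mulVec]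
  have hsymm (t) : (Y t)ᵀ = Y t := by
    rw [← vec_inj, hvecY, ← hY t]
    have h1 : M t *ᵥ vec (Y t)ᵀ = vec (1 : Matrix n n ℝ) := by
      rw [hMvec, covarianceOperator_transpose, ← transpose_smul, ← transpose_smul,
        ← transpose_sub, hY, transpose_one]
    rw [hY, ← h1, mulVec_mulVec, nonsing_inv_mul _ (hdet t), one_mulVec]
  have hcont : Continuous Y := by
    have hMc : Continuous M := by fun_prop
    have hinv : Continuous fun t => (M t)⁻¹ := by
      simp only [inv_def, Ring.inverse_eq_inv']
      exact (hMc.matrix_det.inv₀ fun t => (hdet t).ne_zero).smul hMc.matrix_adjugate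
    have hw : Continuous fun t => (M t)⁻¹ *ᵥ vec (1 : Matrix n n ℝ) :=
      hinv.matrix_mulVec continuous_const
    exact continuous_matrix fun i j => (continuous_apply (j, i)).comp hw
  have hherm (t) : (Y t).IsHermitian := by
    rw [IsHermitian, conjTranspose_eq_transpose_of_trivial, hsymm]
  have hpos (t) (ht : (Y t).PosSemidef) : (Y t).PosDef := by
    refine .of_dotProduct_mulVec_pos (hherm t) fun x hx => ?_
    refine (ht.dotProduct_mulVec_nonneg x).lt_of_ne' fun hzero => ?_
    have hker : Y t *ᵥ x = 0 := (ht.dotProduct_mulVec_zero_iff x).1 hzero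
    have hx' := congrArg (fun N => x ⬝ᵥ (N *ᵥ x)) (hY t)
    simp only [sub_mulVec, smul_mulVec, one_mulVec, dotProduct_sub, dotProduct_smul, smul_eq_mul,
      dotProduct_covarianceOperator_mulVec A B σ _ (hsymm t), hker, dotProduct_zero, mul_zero,
      zero_sub, zero_add] at hx'
    have hxx : 0 < x ⬝ᵥ x := by simpa using dotProduct_star_self_pos_iff.2 hx
    have hsum : 0 ≤ ∑ k, (σ k) ^ 2 * (((B k)ᵀ *ᵥ x) ⬝ᵥ (Y t *ᵥ ((B k)ᵀ *ᵥ x))) :=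
      Finset.sum_nonneg fun k _ => mul_nonneg (sq_nonneg _)
        (by simpa using ht.dotProduct_mulVec_nonneg ((B k)ᵀ *ᵥ x))
    have := mul_nonneg t.2.1 hsum
    linarith
  have h0 : (Y 0).PosDef := by
    have := hY 0
    simp only [Set.Icc.coe_zero, sub_zero, one_smul, zero_smul] at this
    rw [this]
    exact .one
  refine ⟨Y 1, posDef_of_continuous_of_preconnected hcont hherm hpos h0 1, ?_⟩
  have := hY 1
  simp only [Set.Icc.coe_one, sub_self, one_smul, zero_smul, zero_sub] at this
  rw [← this, neg_neg]

/-- A Lyapunov criterion for a matrix to be Hurwitz. -/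
lemma isHurwitz_of_posDef_of_lyapunov [DecidableEq n] {Y : Matrix n n ℝ} (hY : Y.PosDef)
    (hneg : ∀ x ≠ 0, (Aᵀ *ᵥ x) ⬝ᵥ (Y *ᵥ x) < 0) : IsHurwitz A := by
  intro μ hμ
  rw [mem_spectrum_iff_det_eq_zero, ← exists_vecMul_eq_zero_iff] at hμ
  obtain ⟨w, hw0, hw⟩ := hμ
  rw [vecMul_sub, vecMul_smul, vecMul_one, sub_eq_zero] at hw
  let x : n → ℝ := fun i => (w i).re
  let y : n → ℝ := fun i => (w i).im
  have hx : Aᵀ *ᵥ x = μ.re • x - μ.im • y := by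
    ext i
    have := congrArg Complex.re (congrFun hw i)
    simp [vecMul, dotProduct] at this
    simp [mulVec_transpose, vecMul, dotProduct, x, y, this]
  have hy : Aᵀ *ᵥ y = μ.re • y + μ.im • x := by
    ext i
    have := congrArg Complex.im (congrFun hw i)
    simp [vecMul, dotProduct] at this
    simp [mulVec_transpose, vecMul, dotProduct, x, y, this]
  have hcomm : y ⬝ᵥ (Y *ᵥ x) = x ⬝ᵥ (Y *ᵥ y) := by
    have hs : Yᵀ = Y := by simpa [IsHermitian] using hY.isHermitian
    rw [dotProduct_mulVec, ← mulVec_transpose, hs, dotProduct_comm]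
  have hsum : (Aᵀ *ᵥ x) ⬝ᵥ (Y *ᵥ x) + (Aᵀ *ᵥ y) ⬝ᵥ (Y *ᵥ y)
      = μ.re * (x ⬝ᵥ (Y *ᵥ x) + y ⬝ᵥ (Y *ᵥ y)) := by
    rw [hx, hy]
    simp only [sub_dotProduct, add_dotProduct, smul_dotProduct, smul_eq_mul, hcomm]
    ring
  have hle (z : n → ℝ) : (Aᵀ *ᵥ z) ⬝ᵥ (Y *ᵥ z) ≤ 0 := by
    rcases eq_or_ne z 0 with rfl | hz
    · simp
    · exact (hneg z hz).le
  have hnn (z : n → ℝ) : 0 ≤ z ⬝ᵥ (Y *ᵥ z) := by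
    simpa using hY.posSemidef.dotProduct_mulVec_nonneg z
  have hlt : (Aᵀ *ᵥ x) ⬝ᵥ (Y *ᵥ x) + (Aᵀ *ᵥ y) ⬝ᵥ (Y *ᵥ y) < 0 := by
    rcases eq_or_ne x 0 with hx0 | hx0
    · have hy0 : y ≠ 0 := fun hy0 => hw0 <| funext fun i =>
        Complex.ext (congrFun hx0 i) (congrFun hy0 i)
      exact add_neg_of_nonpos_of_neg (hle x) (hneg y hy0)
    · exact add_neg_of_neg_of_nonpos (hneg x hx0) (hle y)
  rw [hsum] at hlt
  exact neg_of_mul_neg_left hlt (add_nonneg (hnn x) (hnn y))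

end Lyapunov

/-- If `𝒜 = A ⊗ I + I ⊗ A + Σₖ σₖ² (Bₖ ⊗ Bₖ)` is Hurwitz, then `A` is Hurwitz. -/
theorem hurwitz_of_vectorized_generator_hurwitz (n p : ℕ) (A : Matrix (Fin n) (Fin n) ℝ)
    (B : Fin p → Matrix (Fin n) (Fin n) ℝ) (σ : Fin p → ℝ)
    (h : IsHurwitz (A ⊗ₖ (1 : Matrix (Fin n) (Fin n) ℝ) + (1 : Matrix (Fin n) (Fin n) ℝ) ⊗ₖ A
      + ∑ k : Fin p, (σ k) ^ 2 • (B k ⊗ₖ B k))) :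
    IsHurwitz A := by
  obtain ⟨Y, hY, hL⟩ := exists_posDef_covarianceOperator_eq_neg_one A B σ h
  refine isHurwitz_of_posDef_of_lyapunov A hY fun x hx => ?_
  have hs : Yᵀ = Y := by simpa [IsHermitian] using hY.isHermitian
  have hq := dotProduct_covarianceOperator_mulVec A B σ Y hs x
  rw [hL, neg_mulVec, one_mulVec, dotProduct_neg] at hq
  have hxx : 0 < x ⬝ᵥ x := by simpa using dotProduct_star_self_pos_iff.2 hx
  have hsum : 0 ≤ ∑ k, (σ k) ^ 2 * (((B k)ᵀ *ᵥ x) ⬝ᵥ (Y *ᵥ ((B k)ᵀ *ᵥ x))) :=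
    Finset.sum_nonneg fun k _ => mul_nonneg (sq_nonneg _)
      (by simpa using hY.posSemidef.dotProduct_mulVec_nonneg ((B k)ᵀ *ᵥ x))
  linarith
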